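/- Assume N > n. Let p_{−n}, …, p_n be real numbers with p_{−k} = p_k, and let a = (a_0, …, a_n) ∈ ℝ^{n+1}. Then the discrete factorization Σ_{k=−n}^n p_k ζ_j^{−k} = a(ζ_j) a(ζ_j^{−1}) holds for all j = −N+1, …, N if and only if p_k = Σ_{i=0}^{n−|k|} a_i a_{i+|k|} for all k = −n, …, n; equivalently, the pseudo-polynomial p factors on the discrete unit circle 𝕋_{2N} with the degree-n factor a if and only if Σ_{k=−n}^n p_k z^{−k} = a(z) a(z^{−1}) holds for all z ∈ ℂ ∖ {0}. -/

import Mathlib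

open Finset Complex Matrix

noncomputable section

/-- The point `ζ_j = exp(iπ j / N)` of the discrete unit circle `𝕋_{2N}`. -/
def zeta (N : ℕ) (j : ℤ) : ℂ := Complex.exp (Real.pi * Complex.I * j / N)

/-- The index set `j = -N+1, …, N`. -/
def Idx (N : ℕ) : Finset ℤ := Finset.Icc (-(N : ℤ) + 1) (N : ℤ)

/-- `a(ζ) = Σ_{k=0}^n a_k ζ^{-k}`. -/
def evC {n : ℕ} (a : Fin (n + 1) → ℝ) (z : ℂ) : ℂ :=
  ∑ k : Fin (n + 1), (a k : ℂ) * z ^ (-(k.val : ℤ))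

/-- The symmetric pseudo-polynomial `Σ_{k=-n}^n p_{|k|} z^{-k}` (coefficients
`p_{-k} = p_k` are encoded by `p : Fin (n+1) → ℝ`). -/
def ppC {n : ℕ} (p : Fin (n + 1) → ℝ) (z : ℂ) : ℂ :=
  ∑ k : Fin (n + 1), (p k : ℂ) * (z ^ (k.val : ℤ) + z ^ (-(k.val : ℤ))) - (p 0 : ℂ)

/-- The autocorrelation coefficients `Σ_i a_i a_{i+k}` of a real vector `a`. -/
def autocorr {n : ℕ} (a : Fin (n + 1) → ℝ) (k : Fin (n + 1)) : ℝ :=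
  ∑ i : Fin (n + 1),
    if h : (i : ℕ) + (k : ℕ) ≤ n then a i * a ⟨(i : ℕ) + (k : ℕ), by omega⟩ else 0

lemma autocorr_eq_sum_sum {n : ℕ} (a : Fin (n + 1) → ℝ) (k : Fin (n + 1)) :
    autocorr a k = ∑ i : Fin (n + 1), ∑ j : Fin (n + 1),
      if (j : ℕ) = i + k then a i * a j else 0 := by
  refine Finset.sum_congr rfl fun i _ => ?_
  split_ifs with h
  · rw [Finset.sum_eq_single (⟨(i : ℕ) + (k : ℕ), by omega⟩ : Fin (n + 1))]
    · simp
    · intro j _ hj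
      exact if_neg fun h' => hj (Fin.ext h')
    · simp
  · exact (Finset.sum_eq_zero fun j _ => if_neg (by omega)).symm

lemma sum_ite_eq_add_mul_zpow {n : ℕ} (z : ℂ) (i j : Fin (n + 1)) :
    (∑ k : Fin (n + 1), if (j : ℕ) = i + k then z ^ ((k : ℕ) : ℤ) + z ^ (-((k : ℕ) : ℤ)) else 0) =
      if i ≤ j then z ^ ((j : ℤ) - (i : ℤ)) + z ^ ((i : ℤ) - (j : ℤ)) else 0 := by
  split_ifs with h
  · have hle : (i : ℕ) ≤ j := h
    rw [Finset.sum_eq_single (⟨(j : ℕ) - (i : ℕ), by omega⟩ : Fin (n + 1))]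
    · rw [if_pos (by simp only; omega)]
      congr 2 <;> simp only <;> omega
    · intro k _ hk
      exact if_neg fun h' => hk (Fin.ext (by simp only; omega))
    · simp
  · have hlt : ¬ (i : ℕ) ≤ j := h
    exact Finset.sum_eq_zero fun k _ => if_neg (by omega)

/-- The product `a(z) a(z⁻¹)` is the pseudo-polynomial whose coefficients are the
autocorrelations of `a`. -/
lemma evC_mul_evC_inv {n : ℕ} (a : Fin (n + 1) → ℝ) {z : ℂ} (hz : z ≠ 0) :
    evC a z * evC a z⁻¹ = ppC (autocorr a) z := by
  have hprod : evC a z * evC a z⁻¹ =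
      ∑ i : Fin (n + 1), ∑ j : Fin (n + 1), (a i : ℂ) * a j * z ^ ((j : ℤ) - (i : ℤ)) := by
    rw [evC, evC, Finset.sum_mul_sum]
    refine Finset.sum_congr rfl fun i _ => Finset.sum_congr rfl fun j _ => ?_
    rw [_root_.inv_zpow', neg_neg, sub_eq_neg_add, zpow_add₀ hz]
    ring
  have hzero : (autocorr a 0 : ℂ) = ∑ i : Fin (n + 1), (a i : ℂ) * a i := by
    simp [autocorr_eq_sum_sum, Fin.val_inj]
  have hsum : ∑ k : Fin (n + 1),
        (autocorr a k : ℂ) * (z ^ ((k : ℕ) : ℤ) + z ^ (-((k : ℕ) : ℤ))) =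
      ∑ i : Fin (n + 1), ∑ j : Fin (n + 1), (a i : ℂ) * a j *
        if i ≤ j then z ^ ((j : ℤ) - (i : ℤ)) + z ^ ((i : ℤ) - (j : ℤ)) else 0 := by
    simp_rw [← sum_ite_eq_add_mul_zpow, autocorr_eq_sum_sum]
    push_cast
    simp_rw [Finset.sum_mul, Finset.mul_sum]
    rw [Finset.sum_comm]
    refine Finset.sum_congr rfl fun i _ => ?_
    rw [Finset.sum_comm]
    refine Finset.sum_congr rfl fun j _ => Finset.sum_congr rfl fun k _ => ?_
    split_ifs <;> simp
  have hsplit : ∑ i : Fin (n + 1), ∑ j : Fin (n + 1), ((a i : ℂ) * a j *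
        if i ≤ j then z ^ ((j : ℤ) - (i : ℤ)) + z ^ ((i : ℤ) - (j : ℤ)) else 0) =
      (∑ i : Fin (n + 1), ∑ j : Fin (n + 1),
        if i ≤ j then (a i : ℂ) * a j * z ^ ((j : ℤ) - (i : ℤ)) else 0) +
      ∑ i : Fin (n + 1), ∑ j : Fin (n + 1),
        if j ≤ i then (a i : ℂ) * a j * z ^ ((j : ℤ) - (i : ℤ)) else 0 := by
    rw [Finset.sum_comm (f := fun i j : Fin (n + 1) =>
      if j ≤ i then (a i : ℂ) * a j * z ^ ((j : ℤ) - (i : ℤ)) else 0)]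
    simp_rw [← Finset.sum_add_distrib]
    refine Finset.sum_congr rfl fun i _ => Finset.sum_congr rfl fun j _ => ?_
    split_ifs <;> ring
  have hdiag : ∑ i : Fin (n + 1), (a i : ℂ) * a i = ∑ i : Fin (n + 1), ∑ j : Fin (n + 1),
      if i = j then (a i : ℂ) * a j * z ^ ((j : ℤ) - (i : ℤ)) else 0 := by
    simp
  rw [hprod, ppC, hsum, hsplit, hzero, hdiag, ← Finset.sum_add_distrib, ← Finset.sum_sub_distrib]
  refine Finset.sum_congr rfl fun i _ => ?_
  rw [← Finset.sum_add_distrib, ← Finset.sum_sub_distrib]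
  refine Finset.sum_congr rfl fun j _ => ?_
  rcases lt_trichotomy i j with h | h | h
  · simp [h.le, h.not_ge, h.ne]
  · simp [h]
  · simp [h.le, h.not_ge, h.ne']

lemma zeta_ne_zero (N : ℕ) (j : ℤ) : zeta N j ≠ 0 := Complex.exp_ne_zero _

lemma zeta_injOn {N : ℕ} (hN : 0 < N) : Set.InjOn (zeta N) (Idx N) := by
  intro j hj k hk h
  rw [Idx, Finset.mem_coe, Finset.mem_Icc] at hj hk
  obtain ⟨m, hm⟩ := Complex.exp_eq_exp_iff_exists_int.mp h
  have hN' : (N : ℂ) ≠ 0 := Nat.cast_ne_zero.mpr hN.ne'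
  have hπ : (Real.pi * Complex.I : ℂ) ≠ 0 :=
    mul_ne_zero (Complex.ofReal_ne_zero.mpr Real.pi_ne_zero) Complex.I_ne_zero
  have hC : (j : ℂ) = k + m * (2 * N) := by
    field_simp at hm
    refine mul_left_cancel₀ hπ ?_
    linear_combination (Real.pi * Complex.I : ℂ) * hm
  have hZ : j = k + m * (2 * N) := by exact_mod_cast hC
  have hm0 : m = 0 := by
    have h1 : m < 1 := by
      by_contra! hc
      nlinarith
    have h2 : -1 < m := by
      by_contra! hc
      nlinarith
    omega
  simpa [hm0] using hZ

lemma card_Idx (N : ℕ) : #(Idx N) = 2 * N := by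
  rw [Idx, Int.card_Icc]
  omega

open Polynomial in
/-- The polynomial `z ^ n * Σ_{k=-n}^n p_{|k|} z^{-k}`. -/
def shiftedPoly {n : ℕ} (p : Fin (n + 1) → ℝ) : ℂ[X] :=
  ∑ k : Fin (n + 1), C (p k : ℂ) * (X ^ (n + (k : ℕ)) + X ^ (n - (k : ℕ))) - C (p 0 : ℂ) * X ^ n

lemma eval_shiftedPoly {n : ℕ} (p : Fin (n + 1) → ℝ) {z : ℂ} (hz : z ≠ 0) :
    (shiftedPoly p).eval z = z ^ n * ppC p z := by
  simp only [shiftedPoly, ppC, Polynomial.eval_sub, Polynomial.eval_finsetSum,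
    Polynomial.eval_mul, Polynomial.eval_add, Polynomial.eval_pow, Polynomial.eval_X,
    Polynomial.eval_C, mul_sub, Finset.mul_sum]
  congr 1
  · refine Finset.sum_congr rfl fun k _ => ?_
    rw [pow_add, pow_sub₀ z hz (by omega), _root_.zpow_neg, zpow_natCast]
    ring
  · ring

lemma natDegree_shiftedPoly_le {n : ℕ} (p : Fin (n + 1) → ℝ) :
    (shiftedPoly p).natDegree ≤ 2 * n := by
  refine (Polynomial.natDegree_sub_le _ _).trans
    (max_le (Polynomial.natDegree_sum_le_of_forall_le _ _ fun k _ => ?_) ?_)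
  · refine (Polynomial.natDegree_C_mul_le _ _).trans (Polynomial.natDegree_add_le_of_degree_le ?_ ?_)
      <;> rw [Polynomial.natDegree_X_pow] <;> omega
  · exact (Polynomial.natDegree_C_mul_X_pow_le _ _).trans (by omega)

lemma coeff_shiftedPoly {n : ℕ} (p : Fin (n + 1) → ℝ) (m : Fin (n + 1)) :
    (shiftedPoly p).coeff (n + (m : ℕ)) = p m := by
  simp only [shiftedPoly, Polynomial.coeff_sub, Polynomial.finsetSum_coeff,
    Polynomial.coeff_C_mul, Polynomial.coeff_add, Polynomial.coeff_X_pow, mul_add,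
    Finset.sum_add_distrib]
  have h1 : ∑ k : Fin (n + 1), (p k : ℂ) * (if n + (m : ℕ) = n + (k : ℕ) then 1 else 0) = p m := by
    simp [Fin.val_inj]
  have h2 : ∑ k : Fin (n + 1), (p k : ℂ) * (if n + (m : ℕ) = n - (k : ℕ) then 1 else 0) =
      p 0 * if n + (m : ℕ) = n then 1 else 0 := by
    rw [Finset.sum_eq_single 0]
    · simp
    · intro k _ hk
      have : (k : ℕ) ≠ 0 := fun h => hk (Fin.ext h)
      rw [if_neg (by omega), mul_zero]
    · simp
  rw [h1, h2]
  ring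

/-- A pseudo-polynomial of degree `n < N` is determined by its values on `𝕋_{2N}`. -/
lemma eq_of_ppC_zeta_eq {N n : ℕ} (hNn : n < N) {p q : Fin (n + 1) → ℝ}
    (h : ∀ j ∈ Idx N, ppC p (zeta N j) = ppC q (zeta N j)) : p = q := by
  have hcard : #((Idx N).image (zeta N)) = 2 * N := by
    rw [Finset.card_image_of_injOn (zeta_injOn (by omega)), card_Idx]
  have hpoly : shiftedPoly p = shiftedPoly q := by
    refine Polynomial.eq_of_natDegree_lt_card_of_eval_eq' _ _ ((Idx N).image (zeta N)) ?_ ?_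
    · intro z hz
      obtain ⟨j, hj, rfl⟩ := Finset.mem_image.mp hz
      rw [eval_shiftedPoly p (zeta_ne_zero N j), eval_shiftedPoly q (zeta_ne_zero N j), h j hj]
    · have hp := natDegree_shiftedPoly_le p
      have hq := natDegree_shiftedPoly_le q
      rw [hcard]
      omega
  funext m
  have hm := congrArg (fun P => P.coeff (n + (m : ℕ))) hpoly
  simpa only [coeff_shiftedPoly, Complex.ofReal_inj] using hm

/-- for `N > n`, the discrete factorization
`p(ζ_j) = a(ζ_j) a(ζ_j^{-1})` for all `j` holds iff `p_k = Σ_{i=0}^{n-|k|} a_i a_{i+|k|}`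
for all `k`, and also iff the global factorization `p(z) = a(z) a(z^{-1})` holds for all
`z ≠ 0`. -/
theorem stmt15 (N n : ℕ) (hn : 1 ≤ n) (hNn : n < N)
    (p a : Fin (n + 1) → ℝ) :
    ((∀ j ∈ Idx N, ppC p (zeta N j) = evC a (zeta N j) * evC a ((zeta N j)⁻¹)) ↔
      (∀ k : Fin (n + 1), p k = ∑ i : Fin (n + 1),
        if h : (i : ℕ) + (k : ℕ) ≤ n then a i * a ⟨(i : ℕ) + (k : ℕ), by omega⟩ else 0)) ∧
    ((∀ j ∈ Idx N, ppC p (zeta N j) = evC a (zeta N j) * evC a ((zeta N j)⁻¹)) ↔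
      (∀ z : ℂ, z ≠ 0 → ppC p z = evC a z * evC a z⁻¹)) := by
  have hcoeff : (∀ j ∈ Idx N, ppC p (zeta N j) = evC a (zeta N j) * evC a ((zeta N j)⁻¹)) →
      p = autocorr a := fun h =>
    eq_of_ppC_zeta_eq hNn fun j hj => (h j hj).trans (evC_mul_evC_inv a (zeta_ne_zero N j))
  have hglobal : p = autocorr a → ∀ z : ℂ, z ≠ 0 → ppC p z = evC a z * evC a z⁻¹ :=
    fun h z hz => h ▸ (evC_mul_evC_inv a hz).symm
  exact ⟨⟨fun h => congrFun (hcoeff h), fun h j _ => hglobal (funext h) _ (zeta_ne_zero N j)⟩,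
    ⟨fun h => hglobal (hcoeff h), fun h j _ => h _ (zeta_ne_zero N j)⟩⟩

end
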